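/- Let α be a Frenet curve in H³ with curvature κ and torsion τ, contained in a totally umbilical surface U_{a,σ} with ⟨a,a⟩ = ε ∈ {−1,0,1}, σ ≠ 0 and ε + σ² > 0 (so ⟨α(s),a⟩ = σ for all s ∈ I). Assume the torsion is a nonzero constant, τ(s) = τ₀ ≠ 0, and κ′(s) ≠ 0 for all s ∈ I. Then there exists a₀ ∈ ℝ such that for all s ∈ I: sin(τ₀ s + a₀) > 0 and κ(s)·sin(τ₀ s + a₀) = |σ|/√(ε+σ²), i.e. κ(s) = |H|/sin(τ₀ s + a₀) where H = σ/√(ε+σ²) is the mean curvature of U_{a,σ}. -/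

import Mathlib

noncomputable section

/-- The Lorentzian bilinear form `⟨x,y⟩ = x₁y₁ + x₂y₂ + x₃y₃ − x₄y₄` on `ℝ⁴`. -/
def lprod (x y : Fin 4 → ℝ) : ℝ :=
  x 0 * y 0 + x 1 * y 1 + x 2 * y 2 - x 3 * y 3

/-- A Frenet curve in the hyperquadric model
`H³ = {p ∈ ℝ⁴ : ⟨p,p⟩ = −1, x₄ > 0}` of hyperbolic 3-space:
a `C⁴` unit-speed curve `α : I → H³` on an open interval `I`, together with a
Frenet frame `T, N, B`, a positive `C²` curvature `κ` and a `C¹` torsion `τ`,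
such that `T(s), N(s), B(s), α(s)` is an orthonormal basis of `(ℝ⁴, ⟨,⟩)` for
each `s ∈ I` and the Frenet equations `T′ = κN + α`, `N′ = −κT + τB`,
`B′ = −τN` hold on `I`. -/
structure FrenetCurveH3 where
  I : Set ℝ
  hopen : IsOpen I
  hconn : I.OrdConnected
  α : ℝ → Fin 4 → ℝ
  T : ℝ → Fin 4 → ℝ
  N : ℝ → Fin 4 → ℝ
  B : ℝ → Fin 4 → ℝ
  κ : ℝ → ℝ
  τ : ℝ → ℝ
  hα_smooth : ContDiffOn ℝ 4 α I
  hκ_smooth : ContDiffOn ℝ 2 κ I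
  hτ_smooth : ContDiffOn ℝ 1 τ I
  hκ_pos : ∀ s ∈ I, 0 < κ s
  h_hyperquadric : ∀ s ∈ I, lprod (α s) (α s) = -1
  h_x4 : ∀ s ∈ I, 0 < α s 3
  hT : ∀ s ∈ I, HasDerivAt α (T s) s
  hTT : ∀ s ∈ I, lprod (T s) (T s) = 1
  hNN : ∀ s ∈ I, lprod (N s) (N s) = 1
  hBB : ∀ s ∈ I, lprod (B s) (B s) = 1
  hTN : ∀ s ∈ I, lprod (T s) (N s) = 0
  hTB : ∀ s ∈ I, lprod (T s) (B s) = 0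
  hNB : ∀ s ∈ I, lprod (N s) (B s) = 0
  hTα : ∀ s ∈ I, lprod (T s) (α s) = 0
  hNα : ∀ s ∈ I, lprod (N s) (α s) = 0
  hBα : ∀ s ∈ I, lprod (B s) (α s) = 0
  hbasis : ∀ s ∈ I, ∀ v : Fin 4 → ℝ,
    lprod v v =
      lprod v (T s) ^ 2 + lprod v (N s) ^ 2 + lprod v (B s) ^ 2 - lprod v (α s) ^ 2
  hFrenetT : ∀ s ∈ I, HasDerivAt T (κ s • N s + α s) s
  hFrenetN : ∀ s ∈ I, HasDerivAt N ((-κ s) • T s + τ s • B s) s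
  hFrenetB : ∀ s ∈ I, HasDerivAt B ((-τ s) • N s) s

theorem lprod_comm (x y : Fin 4 → ℝ) : lprod x y = lprod y x := by
  unfold lprod; ring

theorem lprod_add_left (x y z : Fin 4 → ℝ) : lprod (x + y) z = lprod x z + lprod y z := by
  simp only [lprod, Pi.add_apply]; ring

theorem lprod_smul_left (r : ℝ) (x y : Fin 4 → ℝ) : lprod (r • x) y = r * lprod x y := by
  simp only [lprod, Pi.smul_apply, smul_eq_mul]; ring

theorem HasDerivAt.lprod_const {f : ℝ → Fin 4 → ℝ} {f' : Fin 4 → ℝ} {s : ℝ}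
    (hf : HasDerivAt f f' s) (a : Fin 4 → ℝ) :
    HasDerivAt (fun t => lprod (f t) a) (lprod f' a) s := by
  have h := hasDerivAt_pi.mp hf
  exact ((((h 0).mul_const (a 0)).add ((h 1).mul_const (a 1))).add
    ((h 2).mul_const (a 2))).sub ((h 3).mul_const (a 3))

theorem eq_zero_of_hasDerivAt_of_eqOn_const {f : ℝ → ℝ} {I : Set ℝ} {c f' s : ℝ}
    (hI : IsOpen I) (hf : ∀ t ∈ I, f t = c) (hs : s ∈ I) (h : HasDerivAt f f' s) : f' = 0 :=
  h.unique ((hasDerivAt_const s c).congr_of_eventuallyEq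
    (Filter.eventually_of_mem (hI.mem_nhds hs) hf))

/-- A solution of `u' = ω v`, `v' = -ω u` on an open interval lying on the circle of radius `R`
has `u(s) = R sin (ω s + a₀)` for some phase `a₀`. -/
theorem exists_phase_of_harmonic_system {u v : ℝ → ℝ} {I : Set ℝ} {R ω : ℝ}
    (hI : IsOpen I) (hI' : I.OrdConnected) (hR : 0 < R)
    (hu : ∀ s ∈ I, HasDerivAt u (ω * v s) s) (hv : ∀ s ∈ I, HasDerivAt v (-ω * u s) s)
    (huv : ∀ s ∈ I, u s ^ 2 + v s ^ 2 = R ^ 2) :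
    ∃ a₀ : ℝ, ∀ s ∈ I, u s = R * Real.sin (ω * s + a₀) := by
  rcases I.eq_empty_or_nonempty with rfl | ⟨s₀, hs₀⟩
  · exact ⟨0, by simp⟩
  let z : ℂ := ⟨v s₀, u s₀⟩
  have hz : ‖z‖ = R := by
    rw [Complex.norm_eq_sqrt_sq_add_sq, add_comm, huv s₀ hs₀, Real.sqrt_sq hR.le]
  have hsin : R * Real.sin z.arg = u s₀ := hz ▸ Complex.norm_mul_sin_arg z
  have hcos : R * Real.cos z.arg = v s₀ := hz ▸ Complex.norm_mul_cos_arg z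
  refine ⟨z.arg - ω * s₀, fun s hs => ?_⟩
  let θ : ℝ → ℝ := fun t => ω * t + (z.arg - ω * s₀)
  have hθ : ∀ t, HasDerivAt θ ω t := fun t => by
    exact (((hasDerivAt_id t).const_mul ω).add_const (z.arg - ω * s₀)).congr_deriv (mul_one ω)
  have hθ₀ : θ s₀ = z.arg := by simp [θ]
  let D : ℝ → ℝ := fun t =>
    (u t - R * Real.sin (θ t)) ^ 2 + (v t - R * Real.cos (θ t)) ^ 2
  have hD : ∀ t ∈ I, HasDerivAt D 0 t := fun t ht => by
    have h := (((hu t ht).sub ((hθ t).sin.const_mul R)).pow 2).add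
      (((hv t ht).sub ((hθ t).cos.const_mul R)).pow 2)
    refine h.congr_deriv ?_
    simp only [Pi.sub_apply]
    ring
  have hDs : D s = D s₀ := hI.is_const_of_deriv_eq_zero hI'.isPreconnected
    (fun t ht => (hD t ht).differentiableAt.differentiableWithinAt)
    (fun t ht => (hD t ht).deriv) hs hs₀
  have hD₀ : D s₀ = 0 := by
    simp only [D, hθ₀, hsin, hcos]
    ring
  have hsq : (u s - R * Real.sin (θ s)) ^ 2 = 0 := by
    have h : (u s - R * Real.sin (θ s)) ^ 2 + (v s - R * Real.cos (θ s)) ^ 2 = 0 :=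
      hDs.trans hD₀
    nlinarith [sq_nonneg (u s - R * Real.sin (θ s)), sq_nonneg (v s - R * Real.cos (θ s))]
  exact sub_eq_zero.mp (pow_eq_zero_iff two_ne_zero |>.mp hsq)

/-- If a Frenet curve `α` in `H³` is contained in a totally umbilical surface
`U_{a,σ}` (with `⟨a,a⟩ = ε ∈ {−1,0,1}`, `σ ≠ 0`, `ε + σ² > 0`), has constant
nonzero torsion `τ ≡ τ₀` and `κ′ ≠ 0` on `I`, then
`κ(s) = |H| / sin(τ₀ s + a₀)` for some constant `a₀`, where
`H = σ/√(ε+σ²)` is the mean curvature of `U_{a,σ}`. -/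
theorem curvature_of_constant_torsion_curve_in_umbilical_H3
    (F : FrenetCurveH3) (a : Fin 4 → ℝ) (ε σ : ℝ)
    (hε : ε = -1 ∨ ε = 0 ∨ ε = 1) (haa : lprod a a = ε) (hσ : σ ≠ 0)
    (hεσ : 0 < ε + σ ^ 2)
    (hcontained : ∀ s ∈ F.I, lprod (F.α s) a = σ)
    (τ₀ : ℝ) (hτ₀ : τ₀ ≠ 0) (hτ : ∀ s ∈ F.I, F.τ s = τ₀)
    (hκ' : ∀ s ∈ F.I, deriv F.κ s ≠ 0) :
    ∃ a₀ : ℝ, ∀ s ∈ F.I,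
      0 < Real.sin (τ₀ * s + a₀) ∧
      F.κ s * Real.sin (τ₀ * s + a₀) = |σ| / Real.sqrt (ε + σ ^ 2) := by
  set R := Real.sqrt (ε + σ ^ 2) with hR
  have hRpos : 0 < R := Real.sqrt_pos.mpr hεσ
  have hRsq : R ^ 2 = ε + σ ^ 2 := Real.sq_sqrt hεσ.le
  have hTa : ∀ s ∈ F.I, lprod (F.T s) a = 0 := fun s hs =>
    eq_zero_of_hasDerivAt_of_eqOn_const F.hopen hcontained hs ((F.hT s hs).lprod_const a)
  have hNa : ∀ s ∈ F.I, F.κ s * lprod (F.N s) a = -σ := fun s hs => by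
    have h := eq_zero_of_hasDerivAt_of_eqOn_const F.hopen hTa hs
      ((F.hFrenetT s hs).lprod_const a)
    rw [lprod_add_left, lprod_smul_left, hcontained s hs] at h
    linarith
  have hdN : ∀ s ∈ F.I, HasDerivAt (fun t => lprod (F.N t) a) (τ₀ * lprod (F.B s) a) s :=
    fun s hs => by
      have h := (F.hFrenetN s hs).lprod_const a
      rwa [lprod_add_left, lprod_smul_left, lprod_smul_left, hTa s hs, hτ s hs, mul_zero,
        zero_add] at h
  have hdB : ∀ s ∈ F.I, HasDerivAt (fun t => lprod (F.B t) a) (-τ₀ * lprod (F.N s) a) s :=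
    fun s hs => by
      have h := (F.hFrenetB s hs).lprod_const a
      rwa [lprod_smul_left, hτ s hs] at h
  have hnorm : ∀ s ∈ F.I, lprod (F.N s) a ^ 2 + lprod (F.B s) a ^ 2 = R ^ 2 := fun s hs => by
    have h := F.hbasis s hs a
    rw [lprod_comm a (F.T s), lprod_comm a (F.N s), lprod_comm a (F.B s),
      lprod_comm a (F.α s), hTa s hs, hcontained s hs, haa] at h
    rw [hRsq]
    linarith
  obtain ⟨c, hc, hcσ⟩ : ∃ c : ℝ, c ^ 2 = 1 ∧ c * -σ = |σ| := by
    rcases abs_choice σ with h | h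
    · exact ⟨-1, by norm_num, by rw [h]; ring⟩
    · exact ⟨1, by norm_num, by rw [h]; ring⟩
  obtain ⟨a₀, ha₀⟩ := exists_phase_of_harmonic_system (u := fun t => c * lprod (F.N t) a)
    (v := fun t => c * lprod (F.B t) a) (R := R) (ω := τ₀) F.hopen F.hconn hRpos
    (fun s hs => ((hdN s hs).const_mul c).congr_deriv (by ring))
    (fun s hs => ((hdB s hs).const_mul c).congr_deriv (by ring))
    (fun s hs => by
      rw [mul_pow, mul_pow, hc, one_mul, one_mul, hnorm s hs])
  refine ⟨a₀, fun s hs => ?_⟩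
  have hprod : F.κ s * Real.sin (τ₀ * s + a₀) = |σ| / R := by
    rw [eq_div_iff hRpos.ne', mul_assoc, mul_comm _ R, ← ha₀ s hs, ← hcσ, ← hNa s hs]
    ring
  refine ⟨?_, hprod⟩
  refine pos_of_mul_pos_right (a := F.κ s) ?_ (F.hκ_pos s hs).le
  rw [hprod]
  exact div_pos (abs_pos.mpr hσ) hRpos
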